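/- In Mat_P(ℂ) the identity q·F+·L − L·F+ − L·F0 + (q−1)^{−1}·(q^{n/2+1}·K1·K2^{−1} − q^{k/2+1}·K1 − q^{(n−k)/2+1}·K2 + I)·L = 0 holds. -/

import Mathlib

open scoped Classical

noncomputable section

variable {F V : Type} [Field F] [AddCommGroup V] [Module F V]

/-- `v` covers `u` in the projective geometry `P`. -/
def Covers (u v : Submodule F V) : Prop :=
  u ≤ v ∧ Module.finrank F ↥v = Module.finrank F ↥u + 1

/-- `v` slash-covers `u` (relative to the fixed subspace `y`). -/
def SlashCovers (y u v : Submodule F V) : Prop :=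
  Covers u v ∧ Module.finrank F ↥(v ⊓ y) = Module.finrank F ↥(u ⊓ y) + 1

/-- `v` backslash-covers `u` (relative to the fixed subspace `y`). -/
def BackslashCovers (y u v : Submodule F V) : Prop :=
  Covers u v ∧ Module.finrank F ↥(v ⊓ y) = Module.finrank F ↥(u ⊓ y)

/-- `q` raised to a real exponent, as a complex number. -/
def qpow (q : ℕ) (e : ℝ) : ℂ := (((q : ℝ) ^ e : ℝ) : ℂ)

/-- The Gaussian bracket `[m] = (q^m - 1)/(q - 1)` as a rational number. -/
def gaussQ (q m : ℕ) : ℚ := ((q : ℚ) ^ m - 1) / ((q : ℚ) - 1)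

/-- The Gaussian bracket `[m] = (q^m - 1)/(q - 1)` as a complex number. -/
def gaussC (q m : ℕ) : ℂ := ((q : ℂ) ^ m - 1) / ((q : ℂ) - 1)

/-- The diagonal matrix `K1`; the `(u,u)` entry is `q^(k/2 - i)` for `u ∈ P_{i,j}`. -/
def matK1 (q k : ℕ) (y : Submodule F V) : Matrix (Submodule F V) (Submodule F V) ℂ :=
  Matrix.diagonal fun u => qpow q ((k : ℝ) / 2 - (Module.finrank F ↥(u ⊓ y) : ℝ))

/-- The diagonal matrix `K2`; the `(u,u)` entry is `q^(j - (n-k)/2)` for `u ∈ P_{i,j}`. -/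
def matK2 (q n k : ℕ) (y : Submodule F V) : Matrix (Submodule F V) (Submodule F V) ℂ :=
  Matrix.diagonal fun u =>
    qpow q (((Module.finrank F ↥u : ℝ) - (Module.finrank F ↥(u ⊓ y) : ℝ))
      - ((n : ℝ) - (k : ℝ)) / 2)

/-- The 0-1 matrix `L1`; the `(u,v)` entry is `1` iff `v` slash-covers `u`. -/
def matL1 (y : Submodule F V) : Matrix (Submodule F V) (Submodule F V) ℂ :=
  Matrix.of fun u v => if SlashCovers y u v then (1 : ℂ) else 0

/-- The 0-1 matrix `L2`; the `(u,v)` entry is `1` iff `v` backslash-covers `u`. -/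
def matL2 (y : Submodule F V) : Matrix (Submodule F V) (Submodule F V) ℂ :=
  Matrix.of fun u v => if BackslashCovers y u v then (1 : ℂ) else 0

/-- `R1 = L1ᵀ`. -/
def matR1 (y : Submodule F V) : Matrix (Submodule F V) (Submodule F V) ℂ := Matrix.transpose (matL1 y)

/-- `R2 = L2ᵀ`. -/
def matR2 (y : Submodule F V) : Matrix (Submodule F V) (Submodule F V) ℂ := Matrix.transpose (matL2 y)

/-- `R = L1 · R2`. -/
def matR [Fintype (Submodule F V)] (y : Submodule F V) :
    Matrix (Submodule F V) (Submodule F V) ℂ := matL1 y * matR2 y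

/-- `L = R1 · L2`. -/
def matL [Fintype (Submodule F V)] (y : Submodule F V) :
    Matrix (Submodule F V) (Submodule F V) ℂ := matR1 y * matL2 y

/-- The 0-1 matrix `F0`. -/
def matF0 (y : Submodule F V) : Matrix (Submodule F V) (Submodule F V) ℂ :=
  Matrix.of fun u v =>
    if SlashCovers y u (u ⊔ v) ∧ SlashCovers y v (u ⊔ v) ∧
        BackslashCovers y (u ⊓ v) u ∧ BackslashCovers y (u ⊓ v) v then (1 : ℂ) else 0

/-- The 0-1 matrix `F+`. -/
def matFp (y : Submodule F V) : Matrix (Submodule F V) (Submodule F V) ℂ :=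
  Matrix.of fun u v =>
    if BackslashCovers y u (u ⊔ v) ∧ BackslashCovers y v (u ⊔ v) then (1 : ℂ) else 0

/-- The 0-1 matrix `F-`. -/
def matFm (y : Submodule F V) : Matrix (Submodule F V) (Submodule F V) ℂ :=
  Matrix.of fun u v =>
    if SlashCovers y (u ⊓ v) u ∧ SlashCovers y (u ⊓ v) v then (1 : ℂ) else 0

/-- The vertex set `X` of the Grassmann graph: `k`-dimensional subspaces of `V`. -/
abbrev GrassVertex (F V : Type) [Field F] [AddCommGroup V] [Module F V] (k : ℕ) :=
  {z : Submodule F V // Module.finrank F ↥z = k}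

/-- The Grassmann graph `J_q(n,k)`: vertices are adjacent iff their intersection
has dimension `k - 1`. -/
def Grass (F V : Type) [Field F] [AddCommGroup V] [Module F V] (k : ℕ) :
    SimpleGraph (GrassVertex F V k) :=
  SimpleGraph.fromRel fun a b => Module.finrank F ↥(a.1 ⊓ b.1) = k - 1

/-- `B_xy = {z ∈ Γ(x) : ∂(z,y) = ∂(x,y) + 1}`. -/
def Bset {k : ℕ} (x y : GrassVertex F V k) : Set (GrassVertex F V k) :=
  {z | (Grass F V k).Adj x z ∧ (Grass F V k).dist z y = (Grass F V k).dist x y + 1}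

/-- `C_xy = {z ∈ Γ(x) : ∂(z,y) = ∂(x,y) - 1}`. -/
def Cset {k : ℕ} (x y : GrassVertex F V k) : Set (GrassVertex F V k) :=
  {z | (Grass F V k).Adj x z ∧ (Grass F V k).dist z y = (Grass F V k).dist x y - 1}

/-- `A_xy = {z ∈ Γ(x) : ∂(z,y) = ∂(x,y)}`. -/
def Aset {k : ℕ} (x y : GrassVertex F V k) : Set (GrassVertex F V k) :=
  {z | (Grass F V k).Adj x z ∧ (Grass F V k).dist z y = (Grass F V k).dist x y}

/-- `A0_xy`. -/
def A0set {k : ℕ} (x y : GrassVertex F V k) : Set (GrassVertex F V k) :=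
  {z | (Grass F V k).Adj x z ∧
    SlashCovers y.1 z.1 (z.1 ⊔ x.1) ∧ SlashCovers y.1 x.1 (z.1 ⊔ x.1) ∧
    BackslashCovers y.1 (z.1 ⊓ x.1) z.1 ∧ BackslashCovers y.1 (z.1 ⊓ x.1) x.1}

/-- `A+_xy`. -/
def Apset {k : ℕ} (x y : GrassVertex F V k) : Set (GrassVertex F V k) :=
  {z | (Grass F V k).Adj x z ∧
    BackslashCovers y.1 z.1 (z.1 ⊔ x.1) ∧ BackslashCovers y.1 x.1 (z.1 ⊔ x.1)}

/-- `A-_xy`. -/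
def Amset {k : ℕ} (x y : GrassVertex F V k) : Set (GrassVertex F V k) :=
  {z | (Grass F V k).Adj x z ∧
    SlashCovers y.1 (z.1 ⊓ x.1) z.1 ∧ SlashCovers y.1 (z.1 ⊓ x.1) x.1}

/-- The edge `wz` has type `0`. -/
def EdgeType0 {k : ℕ} (y w z : GrassVertex F V k) : Prop :=
  SlashCovers y.1 w.1 (w.1 ⊔ z.1) ∧ SlashCovers y.1 z.1 (w.1 ⊔ z.1) ∧
  BackslashCovers y.1 (w.1 ⊓ z.1) w.1 ∧ BackslashCovers y.1 (w.1 ⊓ z.1) z.1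

/-- The edge `wz` has type `+`. -/
def EdgeTypeP {k : ℕ} (y w z : GrassVertex F V k) : Prop :=
  BackslashCovers y.1 w.1 (w.1 ⊔ z.1) ∧ BackslashCovers y.1 z.1 (w.1 ⊔ z.1)

/-- The edge `wz` has type `-`. -/
def EdgeTypeM {k : ℕ} (y w z : GrassVertex F V k) : Prop :=
  SlashCovers y.1 (w.1 ⊓ z.1) w.1 ∧ SlashCovers y.1 (w.1 ⊓ z.1) z.1

section Covering

open Module

variable [FiniteDimensional F V]

lemma Covers.inf_le_inf {u v : Submodule F V} (h : Covers u v) (y : Submodule F V) :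
    finrank F ↥(u ⊓ y) ≤ finrank F ↥(v ⊓ y) ∧
      finrank F ↥(v ⊓ y) ≤ finrank F ↥(u ⊓ y) + 1 := by
  refine ⟨Submodule.finrank_mono (inf_le_inf_right y h.1), ?_⟩
  have h₁ := Submodule.finrank_sup_add_finrank_inf_eq u (v ⊓ y)
  have h₂ : finrank F ↥(u ⊔ v ⊓ y) ≤ finrank F ↥v :=
    Submodule.finrank_mono (sup_le h.1 inf_le_left)
  rw [← inf_assoc, inf_eq_left.mpr h.1] at h₁
  have := h.2
  omega

lemma covers_sup_span_singleton {u : Submodule F V} {x : V} (hx : x ∉ u) :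
    Covers u (u ⊔ F ∙ x) :=
  ⟨le_sup_left, Submodule.finrank_sup_span_singleton hx⟩

lemma Covers.sup_span_singleton_eq {u v : Submodule F V} (h : Covers u v) {x : V}
    (hxv : x ∈ v) (hxu : x ∉ u) : u ⊔ F ∙ x = v :=
  Submodule.eq_of_le_of_finrank_eq
    (sup_le h.1 ((Submodule.span_singleton_le_iff_mem x v).mpr hxv))
    ((Submodule.finrank_sup_span_singleton hxu).trans h.2.symm)

lemma Covers.not_le {u v : Submodule F V} (h : Covers u v) : ¬ v ≤ u := fun hvu => by
  have := Submodule.finrank_mono hvu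
  have := h.2
  omega

lemma backslashCovers_iff_inf_le {y u v : Submodule F V} :
    BackslashCovers y u v ↔ Covers u v ∧ v ⊓ y ≤ u := by
  refine and_congr_right fun h => ⟨fun e => ?_, fun hle => ?_⟩
  · rw [← Submodule.eq_of_le_of_finrank_eq (inf_le_inf_right y h.1) e.symm]
    exact inf_le_left
  · rw [le_antisymm (le_inf hle inf_le_right) (inf_le_inf_right y h.1)]

lemma backslashCovers_iff_not_le_sup {y u v : Submodule F V} :
    BackslashCovers y u v ↔ Covers u v ∧ ¬ v ≤ u ⊔ y := by
  rw [backslashCovers_iff_inf_le]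
  refine and_congr_right fun h => ⟨fun hle hv => h.not_le ?_, fun hv => ?_⟩
  · calc v = (u ⊔ y) ⊓ v := (inf_eq_right.mpr hv).symm
      _ = u ⊔ y ⊓ v := sup_inf_assoc_of_le y h.1
      _ ≤ u := sup_le le_rfl (inf_comm y v ▸ hle)
  · by_contra hle
    obtain ⟨x, hx, hxu⟩ := SetLike.not_le_iff_exists.mp hle
    refine hv ?_
    rw [← h.sup_span_singleton_eq hx.1 hxu]
    exact sup_le_sup_left ((Submodule.span_singleton_le_iff_mem x y).mpr hx.2) u

/-- The submodular inequality for intersections with a fixed subspace. -/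
lemma finrank_inf_add_finrank_inf_le (y u v : Submodule F V) :
    finrank F ↥(u ⊓ y) + finrank F ↥(v ⊓ y) ≤
      finrank F ↥((u ⊔ v) ⊓ y) + finrank F ↥((u ⊓ v) ⊓ y) := by
  have h₁ := Submodule.finrank_sup_add_finrank_inf_eq (u ⊓ y) (v ⊓ y)
  have h₂ : finrank F ↥(u ⊓ y ⊔ v ⊓ y) ≤ finrank F ↥((u ⊔ v) ⊓ y) :=
    Submodule.finrank_mono
      (sup_le (inf_le_inf_right y le_sup_left) (inf_le_inf_right y le_sup_right))
  rw [← inf_inf_distrib_right] at h₁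
  omega

lemma covers_sup_iff_covers_inf {u v : Submodule F V} :
    Covers u (u ⊔ v) ∧ Covers v (u ⊔ v) ↔ Covers (u ⊓ v) u ∧ Covers (u ⊓ v) v := by
  have := Submodule.finrank_sup_add_finrank_inf_eq u v
  simp only [Covers, le_sup_left, le_sup_right, inf_le_left, inf_le_right, true_and]
  omega

lemma Covers.eq_sup {u v w : Submodule F V} (hu : Covers u w) (hv : Covers v w) (hne : u ≠ v) :
    w = u ⊔ v := by
  refine (Submodule.eq_of_le_of_finrank_le (sup_le hu.1 hv.1) ?_).symm
  by_contra hlt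
  have h₁ := hu.2
  have h₂ := hv.2
  have h₃ := Submodule.finrank_mono (le_sup_left : u ≤ u ⊔ v)
  have e₁ := Submodule.eq_of_le_of_finrank_le (le_sup_left : u ≤ u ⊔ v) (by omega)
  have e₂ := Submodule.eq_of_le_of_finrank_le (le_sup_right : v ≤ u ⊔ v) (by omega)
  exact hne (e₁.trans e₂.symm)

lemma Covers.eq_inf {u v w : Submodule F V} (hu : Covers w u) (hv : Covers w v) (hne : u ≠ v) :
    w = u ⊓ v := by
  refine Submodule.eq_of_le_of_finrank_le (le_inf hu.1 hv.1) ?_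
  by_contra hlt
  have h₁ := hu.2
  have h₂ := hv.2
  have e₁ := Submodule.eq_of_le_of_finrank_le (inf_le_left : u ⊓ v ≤ u) (by omega)
  have e₂ := Submodule.eq_of_le_of_finrank_le (inf_le_right : u ⊓ v ≤ v) (by omega)
  exact hne (e₁.symm.trans e₂)

lemma backslash_slash_sup_iff_slash_backslash_inf {y u v : Submodule F V} :
    BackslashCovers y u (u ⊔ v) ∧ SlashCovers y v (u ⊔ v) ↔
      SlashCovers y (u ⊓ v) u ∧ BackslashCovers y (u ⊓ v) v := by
  have hsub := finrank_inf_add_finrank_inf_le y u v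
  constructor
  · rintro ⟨⟨h₁, e₁⟩, h₂, e₂⟩
    obtain ⟨h₃, h₄⟩ := covers_sup_iff_covers_inf.mp ⟨h₁, h₂⟩
    have := h₃.inf_le_inf y
    have := h₄.inf_le_inf y
    exact ⟨⟨h₃, by omega⟩, h₄, by omega⟩
  · rintro ⟨⟨h₁, e₁⟩, h₂, e₂⟩
    obtain ⟨h₃, h₄⟩ := covers_sup_iff_covers_inf.mpr ⟨h₁, h₂⟩
    have := h₃.inf_le_inf y
    have := h₄.inf_le_inf y
    exact ⟨⟨h₃, by omega⟩, h₄, by omega⟩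

lemma backslash_inf_iff {y u v : Submodule F V} :
    BackslashCovers y (u ⊓ v) u ∧ BackslashCovers y (u ⊓ v) v ↔
      (BackslashCovers y u (u ⊔ v) ∧ BackslashCovers y v (u ⊔ v)) ∨
        (SlashCovers y u (u ⊔ v) ∧ SlashCovers y v (u ⊔ v) ∧
          BackslashCovers y (u ⊓ v) u ∧ BackslashCovers y (u ⊓ v) v) := by
  have hsub := finrank_inf_add_finrank_inf_le y u v
  constructor
  · rintro ⟨⟨h₁, e₁⟩, h₂, e₂⟩
    obtain ⟨h₃, h₄⟩ := covers_sup_iff_covers_inf.mpr ⟨h₁, h₂⟩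
    have h₅ := h₃.inf_le_inf y
    rcases h₅.1.eq_or_lt with h | h
    · exact Or.inl ⟨⟨h₃, by omega⟩, h₄, by omega⟩
    · exact Or.inr ⟨⟨h₃, by omega⟩, ⟨h₄, by omega⟩, ⟨h₁, e₁⟩, h₂, e₂⟩
  · rintro (⟨⟨h₁, e₁⟩, h₂, e₂⟩ | h)
    · obtain ⟨h₃, h₄⟩ := covers_sup_iff_covers_inf.mp ⟨h₁, h₂⟩
      have := h₃.inf_le_inf y
      have := h₄.inf_le_inf y
      exact ⟨⟨h₃, by omega⟩, h₄, by omega⟩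
    · exact h.2.2

end Covering

section Counting

open Module Finset

lemma card_sdiff_submodule [Fintype F] [Fintype V] {t s : Submodule F V} (hts : t ≤ s) :
    (#{x : V | x ∈ s ∧ x ∉ t} : ℂ) =
      (Fintype.card F : ℂ) ^ finrank F ↥s - (Fintype.card F : ℂ) ^ finrank F ↥t := by
  have hcard (w : Submodule F V) : #{x : V | x ∈ w} = Fintype.card F ^ finrank F ↥w := by
    rw [← Module.card_eq_pow_finrank (K := F) (V := w)]
    exact (Fintype.card_subtype _).symm
  have h : #{x : V | x ∈ s ∧ x ∉ t} + #{x : V | x ∈ t} = #{x : V | x ∈ s} := by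
    rw [← card_union_of_disjoint]
    · congr 1
      ext x
      simp only [mem_union, mem_filter_univ]
      exact ⟨fun h => h.elim And.left (@hts x), fun h => or_iff_not_imp_right.mpr fun h' => ⟨h, h'⟩⟩
    · rw [Finset.disjoint_left]
      simp only [mem_filter_univ]
      exact fun x h => h.2
  rw [hcard, hcard] at h
  rw [eq_sub_iff_add_eq]
  exact_mod_cast h

variable [Fintype F] [FiniteDimensional F V] [Fintype (Submodule F V)]

lemma card_covers_not_le {u t s : Submodule F V} (hut : u ≤ t) (hts : t ≤ s) :
    (#{w : Submodule F V | Covers u w ∧ w ≤ s ∧ ¬ w ≤ t} : ℂ) *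
        ((Fintype.card F : ℂ) ^ (finrank F ↥u + 1) - (Fintype.card F : ℂ) ^ finrank F ↥u) =
      (Fintype.card F : ℂ) ^ finrank F ↥s - (Fintype.card F : ℂ) ^ finrank F ↥t := by
  have : Finite V := Module.finite_of_finite F
  have : Fintype V := Fintype.ofFinite V
  have hmaps : Set.MapsTo (fun x : V => u ⊔ F ∙ x) ({x : V | x ∈ s ∧ x ∉ t} : Finset V)
      ({w : Submodule F V | Covers u w ∧ w ≤ s ∧ ¬ w ≤ t} : Finset (Submodule F V)) := by
    intro x hx
    simp only [coe_filter, mem_univ, true_and, Set.mem_ofPred_eq] at hx ⊢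
    exact ⟨covers_sup_span_singleton fun h => hx.2 (hut h),
      sup_le (hut.trans hts) ((Submodule.span_singleton_le_iff_mem x s).mpr hx.1),
      fun h => hx.2 ((Submodule.span_singleton_le_iff_mem x t).mp (le_sup_right.trans h))⟩
  rw [← card_sdiff_submodule hts, card_eq_sum_card_fiberwise hmaps, Nat.cast_sum,
    ← nsmul_eq_mul, ← sum_const]
  refine sum_congr rfl fun w hw => ?_
  obtain ⟨huw, hws, hwt⟩ := mem_filter_univ w |>.mp hw
  rw [← huw.2, ← card_sdiff_submodule huw.1]
  congr 2
  ext x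
  simp only [mem_filter, mem_univ, true_and]
  constructor
  · rintro ⟨hxw, hxu⟩
    have e := huw.sup_span_singleton_eq hxw hxu
    refine ⟨⟨hws hxw, fun hxt => hwt ?_⟩, e⟩
    rw [← e]
    exact sup_le hut ((Submodule.span_singleton_le_iff_mem x t).mpr hxt)
  · rintro ⟨⟨_, hxt⟩, rfl⟩
    exact ⟨le_sup_right (a := u) (Submodule.mem_span_singleton_self x), fun h => hxt (hut h)⟩

lemma card_backslashCovers (y u : Submodule F V) :
    (#{w : Submodule F V | BackslashCovers y u w} : ℂ) *
        ((Fintype.card F : ℂ) ^ (finrank F ↥u + 1) - (Fintype.card F : ℂ) ^ finrank F ↥u) =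
      (Fintype.card F : ℂ) ^ finrank F V - (Fintype.card F : ℂ) ^ finrank F ↥(u ⊔ y) := by
  rw [← finrank_top F V, ← card_covers_not_le (le_sup_left : u ≤ u ⊔ y) le_top]
  simp only [backslashCovers_iff_not_le_sup, le_top, true_and]

lemma card_backslashCovers_below (y u : Submodule F V) :
    (#{w : Submodule F V | BackslashCovers y w u} : ℂ) * ((Fintype.card F : ℂ) - 1) =
      (Fintype.card F : ℂ) ^ (finrank F ↥u - finrank F ↥(u ⊓ y)) - 1 := by
  let φ := Subspace.orderIsoFiniteDimensional (K := F) (V := V)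
  have : Fintype (Submodule F (Dual F V)) :=
    Fintype.ofEquiv _ (φ.toEquiv.trans OrderDual.ofDual)
  have hdim (w : Submodule F V) := Subspace.finrank_add_finrank_dualAnnihilator_eq w
  have hle {a b : Submodule F V} : a.dualAnnihilator ≤ b.dualAnnihilator ↔ b ≤ a :=
    Subspace.dualAnnihilator_le_dualAnnihilator_iff
  have hcov {a b : Submodule F V} :
      Covers a.dualAnnihilator b.dualAnnihilator ↔ Covers b a := by
    have := hdim a
    have := hdim b
    unfold Covers
    rw [hle]
    refine and_congr_right fun _ => ?_
    omega
  have hcard : #{w : Submodule F V | BackslashCovers y w u} =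
      #{w : Submodule F (Dual F V) | Covers u.dualAnnihilator w ∧
        w ≤ (u ⊓ y).dualAnnihilator ∧ ¬ w ≤ u.dualAnnihilator} := by
    refine card_equiv (φ.toEquiv.trans OrderDual.ofDual) fun w => ?_
    have hφ : (φ.toEquiv.trans OrderDual.ofDual) w = w.dualAnnihilator := rfl
    rw [hφ, mem_filter_univ, mem_filter_univ, hcov, hle, hle, backslashCovers_iff_inf_le]
    refine and_congr_right fun h => (and_iff_left h.not_le).symm
  have h := card_covers_not_le (le_refl u.dualAnnihilator)
    (hle.mpr (inf_le_left : u ⊓ y ≤ u))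
  rw [← hcard] at h
  have h₁ := hdim u
  have h₂ := hdim (u ⊓ y)
  have h₃ := Submodule.finrank_mono (inf_le_left : u ⊓ y ≤ u)
  have e : finrank F ↥(u ⊓ y).dualAnnihilator =
    finrank F ↥u.dualAnnihilator + (finrank F ↥u - finrank F ↥(u ⊓ y)) := by omega
  have hq : (Fintype.card F : ℂ) ^ finrank F ↥u.dualAnnihilator ≠ 0 :=
    pow_ne_zero _ (Nat.cast_ne_zero.mpr Fintype.card_ne_zero)
  rw [e, pow_add, pow_succ] at h
  refine mul_left_cancel₀ hq ?_
  linear_combination h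

end Counting

section MatrixRelations

open Module Finset

variable [Fintype (Submodule F V)] (y u v : Submodule F V)

lemma matL2_mul_matR1_apply :
    (matL2 y * matR1 y) u v =
      #{w : Submodule F V | BackslashCovers y u w ∧ SlashCovers y v w} := by
  simp [Matrix.mul_apply, matL2, matR1, matL1, ← ite_and, and_comm]

lemma matR1_mul_matL2_apply :
    (matR1 y * matL2 y) u v =
      #{w : Submodule F V | SlashCovers y w u ∧ BackslashCovers y w v} := by
  simp [Matrix.mul_apply, matL2, matR1, matL1, ← ite_and, and_comm]

lemma matR1_mul_matR2_apply :
    (matR1 y * matR2 y) u v =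
      #{w : Submodule F V | SlashCovers y w u ∧ BackslashCovers y v w} := by
  simp [Matrix.mul_apply, matL2, matR1, matL1, matR2, ← ite_and, and_comm]

lemma matR2_mul_matR1_apply :
    (matR2 y * matR1 y) u v =
      #{w : Submodule F V | BackslashCovers y w u ∧ SlashCovers y v w} := by
  simp [Matrix.mul_apply, matL2, matR1, matL1, matR2, ← ite_and, and_comm]

lemma matL2_mul_matR2_apply :
    (matL2 y * matR2 y) u v =
      #{w : Submodule F V | BackslashCovers y u w ∧ BackslashCovers y v w} := by
  simp [Matrix.mul_apply, matL2, matR2, ← ite_and, and_comm]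

lemma matR2_mul_matL2_apply :
    (matR2 y * matL2 y) u v =
      #{w : Submodule F V | BackslashCovers y w u ∧ BackslashCovers y w v} := by
  simp [Matrix.mul_apply, matL2, matR2, ← ite_and, and_comm]

variable {y u v}

lemma card_filter_eq_ite_of_unique {α : Type*} [Fintype α] {p : α → Prop} [DecidablePred p]
    (a : α) (h : ∀ w, p w → w = a) : (#{w | p w} : ℂ) = if p a then 1 else 0 := by
  have e : ({w | p w} : Finset α) = ({w ∈ {a} | p w} : Finset α) := by
    ext w
    simp only [mem_filter, mem_univ, true_and, mem_singleton]
    exact ⟨fun hw => ⟨h w hw, hw⟩, And.right⟩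
  rw [e, filter_singleton]
  split_ifs <;> simp

variable [FiniteDimensional F V]

variable (y) in
lemma matL2_mul_matR1_eq : matL2 y * matR1 y = matR1 y * matL2 y := by
  ext u v
  rw [matL2_mul_matR1_apply, matR1_mul_matL2_apply,
    card_filter_eq_ite_of_unique (u ⊔ v), card_filter_eq_ite_of_unique (u ⊓ v)]
  · simp only [backslash_slash_sup_iff_slash_backslash_inf]
  · rintro w ⟨h₁, h₂⟩
    refine h₁.1.eq_inf h₂.1 ?_
    rintro rfl
    have := h₁.2
    have := h₂.2
    omega
  · rintro w ⟨h₁, h₂⟩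
    refine h₁.1.eq_sup h₂.1 ?_
    rintro rfl
    have := h₁.2
    have := h₂.2
    omega

variable (y) in
lemma matFp_eq : matFp y = matL2 y * matR2 y -
    Matrix.diagonal fun u => (#{w : Submodule F V | BackslashCovers y u w} : ℂ) := by
  ext u v
  rw [Matrix.sub_apply, matL2_mul_matR2_apply]
  by_cases huv : u = v
  · subst huv
    have h : ¬ BackslashCovers y u u := fun h => h.1.not_le le_rfl
    simp [matFp, h]
  · rw [card_filter_eq_ite_of_unique (u ⊔ v) fun w hw => hw.1.1.eq_sup hw.2.1 huv,
      Matrix.diagonal_apply_ne _ huv, sub_zero]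
    rfl

variable (y) in
lemma matFp_add_matF0_eq : matFp y + matF0 y = matR2 y * matL2 y -
    Matrix.diagonal fun u => (#{w : Submodule F V | BackslashCovers y w u} : ℂ) := by
  ext u v
  rw [Matrix.sub_apply, matR2_mul_matL2_apply]
  by_cases huv : u = v
  · subst huv
    have h : ¬ BackslashCovers y u u := fun h => h.1.not_le le_rfl
    simp [matFp, matF0, h]
  · rw [card_filter_eq_ite_of_unique (u ⊓ v) fun w hw => hw.1.1.eq_inf hw.2.1 huv,
      Matrix.diagonal_apply_ne _ huv, sub_zero]
    have hdisj : ¬ (BackslashCovers y u (u ⊔ v) ∧ SlashCovers y u (u ⊔ v)) := by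
      rintro ⟨⟨-, h₁⟩, -, h₂⟩
      omega
    have hiff := backslash_inf_iff (y := y) (u := u) (v := v)
    simp only [matFp, matF0, Matrix.add_apply, Matrix.of_apply]
    split_ifs <;> first | (simp; done) | (exfalso; tauto)

variable (y) in
lemma matR1_mul_matR2_eq [Fintype F] :
    matR1 y * matR2 y = (Fintype.card F : ℂ) • (matR2 y * matR1 y) := by
  ext u v
  rw [Matrix.smul_apply, matR1_mul_matR2_apply, matR2_mul_matR1_apply, smul_eq_mul]
  by_cases hQ : v ≤ u ∧ finrank F ↥u = finrank F ↥v + 2 ∧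
      finrank F ↥(u ⊓ y) = finrank F ↥(v ⊓ y) + 1
  · obtain ⟨hvu, hdim, hdimy⟩ := hQ
    have ht : finrank F ↥(v ⊔ u ⊓ y) = finrank F ↥v + 1 := by
      have h := Submodule.finrank_sup_add_finrank_inf_eq v (u ⊓ y)
      rw [← inf_assoc, inf_eq_left.mpr hvu] at h
      omega
    have htu : v ⊔ u ⊓ y ≤ u := sup_le hvu inf_le_left
    have hle {w : Submodule F V} (hwu : w ≤ u) : w ≤ v ⊔ y ↔ w ≤ v ⊔ u ⊓ y := by
      rw [inf_comm u y, ← sup_inf_assoc_of_le y hvu, le_inf_iff, and_iff_left hwu]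
    have hcov {w : Submodule F V} (h : Covers v w) (hwu : w ≤ u) : Covers w u :=
      ⟨hwu, by have := h.2; omega⟩
    have h₁ (w : Submodule F V) : SlashCovers y w u ∧ BackslashCovers y v w ↔
        Covers v w ∧ w ≤ u ∧ ¬ w ≤ v ⊔ u ⊓ y := by
      constructor
      · rintro ⟨h, h'⟩
        have h'' := (backslashCovers_iff_not_le_sup.mp h').2
        exact ⟨h'.1, h.1.1, fun hw => h'' ((hle h.1.1).mpr hw)⟩
      · rintro ⟨h, hwu, hw⟩
        have h' := backslashCovers_iff_not_le_sup.mpr ⟨h, fun hw' => hw ((hle hwu).mp hw')⟩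
        exact ⟨⟨hcov h hwu, by rw [h'.2, hdimy]⟩, h'⟩
    have h₂ (w : Submodule F V) : BackslashCovers y w u ∧ SlashCovers y v w ↔
        w = v ⊔ u ⊓ y := by
      constructor
      · rintro ⟨h, h'⟩
        refine (Submodule.eq_of_le_of_finrank_eq (sup_le h'.1.1 ?_) (ht.trans h'.1.2.symm)).symm
        exact (backslashCovers_iff_inf_le.mp h).2
      · rintro rfl
        have h : Covers v (v ⊔ u ⊓ y) := ⟨le_sup_left, ht⟩
        have h' := backslashCovers_iff_inf_le.mpr ⟨hcov h htu, le_sup_right⟩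
        exact ⟨h', h, by rw [← h'.2, hdimy]⟩
    have hcount := card_covers_not_le (le_sup_left : v ≤ v ⊔ u ⊓ y) htu
    simp only [h₁, h₂]
    have hq : (Fintype.card F : ℂ) ≠ 1 := by
      exact_mod_cast Fintype.one_lt_card.ne'
    rw [filter_eq' univ, if_pos (mem_univ _), card_singleton, Nat.cast_one, mul_one]
    rw [ht, hdim] at hcount
    have hne : (Fintype.card F : ℂ) ^ (finrank F ↥v + 1) -
        (Fintype.card F : ℂ) ^ finrank F ↥v ≠ 0 := by
      rw [pow_succ, ← mul_sub_one]
      exact mul_ne_zero (pow_ne_zero _ (by rintro h; simp at h)) (sub_ne_zero.mpr hq)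
    refine mul_right_cancel₀ hne (hcount.trans ?_)
    ring
  · rw [filter_false_of_mem, filter_false_of_mem]
    · simp
    · rintro w - ⟨h, h'⟩
      refine hQ ⟨h'.1.1.trans h.1.1, ?_, ?_⟩
      · rw [h.1.2, h'.1.2]
      · rw [← h'.2, h.2]
    · rintro w - ⟨h, h'⟩
      refine hQ ⟨h'.1.1.trans h.1.1, ?_, ?_⟩
      · rw [h.1.2, h'.1.2]
      · rw [h.2, h'.2]

end MatrixRelations

section Coefficients

open Module

lemma qpow_add {q : ℕ} (hq : 0 < q) (a b : ℝ) : qpow q (a + b) = qpow q a * qpow q b := by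
  simp only [qpow, Real.rpow_add (Nat.cast_pos.mpr hq), Complex.ofReal_mul]

lemma qpow_natCast (q m : ℕ) : qpow q m = (q : ℂ) ^ m := by
  simp [qpow, Real.rpow_natCast]

lemma matK2_inv {q : ℕ} (hq : 0 < q) (n k : ℕ) (y : Submodule F V) [Fintype (Submodule F V)] :
    (matK2 q n k y)⁻¹ = Matrix.diagonal fun u : Submodule F V =>
      qpow q (((n : ℝ) - (k : ℝ)) / 2 - ((finrank F ↥u : ℝ) - (finrank F ↥(u ⊓ y) : ℝ))) := by
  refine Matrix.inv_eq_right_inv ?_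
  rw [matK2, Matrix.diagonal_mul_diagonal, ← Matrix.diagonal_one]
  congr 1
  ext u
  rw [← qpow_add hq, sub_add_sub_cancel, sub_self]
  simp [qpow]

/-- The diagonal coefficient of `L` in the relation, written with integral powers of `q`. -/
lemma coefficient_eq_diagonal {q n k : ℕ} (hq : 0 < q) [FiniteDimensional F V]
    [Fintype (Submodule F V)] (hdim : finrank F V = n)
    (y : Submodule F V) (hy : finrank F ↥y = k) :
    ((q : ℂ) - 1)⁻¹ • (qpow q ((n : ℝ) / 2 + 1) • (matK1 q k y * (matK2 q n k y)⁻¹)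
        - qpow q ((k : ℝ) / 2 + 1) • matK1 q k y
        - qpow q (((n : ℝ) - (k : ℝ)) / 2 + 1) • matK2 q n k y
        + (1 : Matrix (Submodule F V) (Submodule F V) ℂ)) =
      Matrix.diagonal fun u : Submodule F V => ((q : ℂ) - 1)⁻¹ *
        ((q : ℂ) ^ (n - finrank F ↥u + 1) - (q : ℂ) ^ (k - finrank F ↥(u ⊓ y) + 1)
          - (q : ℂ) ^ (finrank F ↥u - finrank F ↥(u ⊓ y) + 1) + 1) := by
  rw [matK2_inv hq, matK1, matK2, Matrix.diagonal_mul_diagonal, ← Matrix.diagonal_one]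
  simp only [← Matrix.diagonal_smul, Matrix.diagonal_sub, Matrix.diagonal_add]
  congr 1
  ext u
  have h₁ : finrank F ↥u ≤ n := hdim ▸ Submodule.finrank_le u
  have h₂ : finrank F ↥(u ⊓ y) ≤ k := hy ▸ Submodule.finrank_mono inf_le_right
  have h₃ : finrank F ↥(u ⊓ y) ≤ finrank F ↥u := Submodule.finrank_mono inf_le_left
  simp only [Pi.smul_apply, smul_eq_mul, ← qpow_add hq, ← qpow_natCast]
  push_cast [h₁, h₂, h₃]
  congr 4 <;> first | ring1 | (congr 1; ring1)

end Coefficients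

theorem statement4
    (q n k : ℕ) (hq : IsPrimePow q) (hkn : k < n) (hk : 1 ≤ k)
    (F V : Type) [Field F] [Fintype F] (hcard : Fintype.card F = q)
    [AddCommGroup V] [Module F V] [FiniteDimensional F V]
    (hdim : Module.finrank F V = n)
    [Fintype (Submodule F V)]
    (y : Submodule F V) (hy : Module.finrank F ↥y = k) :
    (q : ℂ) • (matFp y * matL y) - matL y * matFp y - matL y * matF0 y +
      (((q : ℂ) - 1)⁻¹ • (qpow q ((n : ℝ) / 2 + 1) • (matK1 q k y * (matK2 q n k y)⁻¹)
        - qpow q ((k : ℝ) / 2 + 1) • matK1 q k y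
        - qpow q (((n : ℝ) - (k : ℝ)) / 2 + 1) • matK2 q n k y
        + (1 : Matrix (Submodule F V) (Submodule F V) ℂ))) * matL y = 0 := by
  have hq1 : (q : ℂ) - 1 ≠ 0 := sub_ne_zero.mpr (by exact_mod_cast hq.one_lt.ne')
  have hq0 : (q : ℂ) ≠ 0 := by exact_mod_cast hq.pos.ne'
  rw [coefficient_eq_diagonal hq.pos hdim y hy, sub_sub, ← mul_add, matFp_add_matF0_eq y,
    matFp_eq y]
  set D₁ : Submodule F V → ℂ := fun u =>
    (Finset.card {w : Submodule F V | BackslashCovers y u w} : ℂ)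
  set D₂ : Submodule F V → ℂ := fun u =>
    (Finset.card {w : Submodule F V | BackslashCovers y w u} : ℂ)
  have hcomm : (q : ℂ) • (matL2 y * matR2 y * matL y) = matL y * (matR2 y * matL2 y) := by
    calc (q : ℂ) • (matL2 y * matR2 y * matL y)
        = matL2 y * ((q : ℂ) • (matR2 y * matR1 y)) * matL2 y := by
          simp only [matL, Matrix.mul_smul, Matrix.smul_mul, Matrix.mul_assoc]
      _ = matL2 y * matR1 y * (matR2 y * matL2 y) := by
          rw [← hcard, ← matR1_mul_matR2_eq]
          simp only [Matrix.mul_assoc]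
      _ = matL y * (matR2 y * matL2 y) := by rw [matL2_mul_matR1_eq, matL]
  rw [Matrix.sub_mul, Matrix.mul_sub, smul_sub, hcomm]
  ext u v
  simp only [Matrix.add_apply, Matrix.sub_apply, Matrix.smul_apply, Matrix.diagonal_mul,
    Matrix.mul_diagonal, Matrix.zero_apply, smul_eq_mul]
  suffices h : matL y u v = 0 ∨ D₂ v - q * D₁ u + ((q : ℂ) - 1)⁻¹ *
      ((q : ℂ) ^ (n - Module.finrank F ↥u + 1) - (q : ℂ) ^ (k - Module.finrank F ↥(u ⊓ y) + 1)
        - (q : ℂ) ^ (Module.finrank F ↥u - Module.finrank F ↥(u ⊓ y) + 1) + 1) = 0 by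
    rcases h with h | h
    · simp [h]
    · linear_combination matL y u v * h
  refine or_iff_not_imp_left.mpr fun hL => ?_
  rw [matL, matR1_mul_matL2_apply, Nat.cast_eq_zero, Finset.card_eq_zero,
    ← Ne, ← Finset.nonempty_iff_ne_empty] at hL
  obtain ⟨w, hw⟩ := hL
  obtain ⟨⟨⟨-, hu⟩, huy⟩, ⟨-, hv⟩, hvy⟩ := (Finset.mem_filter_univ w).mp hw
  have h₁ := card_backslashCovers y u
  have h₂ := card_backslashCovers_below y v
  have hsup := Submodule.finrank_sup_add_finrank_inf_eq u y
  have hle₁ : Module.finrank F ↥(u ⊔ y) ≤ n := hdim ▸ Submodule.finrank_le _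
  have hle₂ : Module.finrank F ↥(u ⊓ y) ≤ Module.finrank F ↥u :=
    Submodule.finrank_mono inf_le_left
  have hle₃ : Module.finrank F ↥(u ⊓ y) ≤ Module.finrank F ↥y :=
    Submodule.finrank_mono inf_le_right
  have hle₄ : Module.finrank F ↥u ≤ Module.finrank F ↥(u ⊔ y) :=
    Submodule.finrank_mono le_sup_left
  have e₁ : (q : ℂ) ^ n = (q : ℂ) ^ Module.finrank F ↥u * (q : ℂ) ^ (n - Module.finrank F ↥u) := by
    rw [← pow_add, Nat.add_sub_cancel' (by omega)]
  have e₂ : Module.finrank F ↥(u ⊔ y) =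
    Module.finrank F ↥u + (k - Module.finrank F ↥(u ⊓ y)) := by omega
  have e₃ : Module.finrank F ↥v - Module.finrank F ↥(v ⊓ y) =
    Module.finrank F ↥u - Module.finrank F ↥(u ⊓ y) + 1 := by omega
  rw [hcard, hdim, e₂, pow_add _ _ (k - _), e₁] at h₁
  rw [hcard, e₃] at h₂
  have h₁' : D₁ u * ((q : ℂ) - 1) = (q : ℂ) ^ (n - Module.finrank F ↥u) -
      (q : ℂ) ^ (k - Module.finrank F ↥(u ⊓ y)) := by
    refine mul_left_cancel₀ (pow_ne_zero (Module.finrank F ↥u) hq0) ?_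
    linear_combination h₁
  have h₂' : D₂ v * ((q : ℂ) - 1) =
      (q : ℂ) ^ (Module.finrank F ↥u - Module.finrank F ↥(u ⊓ y) + 1) - 1 := h₂
  field_simp
  linear_combination h₂' - q * h₁'
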